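/- arXiv:2111.06233 — 2 statements merged into one kernel-verified Lean document; each statement's English description precedes it below -/
import Mathlib

section
/- Let A be a triangulated category with shift functor Σ admitting all set-indexed coproducts, and let g be a compact object of A such that A = loc(g), the smallest localising subcategory of A containing g. If x is an object of A such that Hom_A(g, Σ^j x) = 0 for all j ∈ ℤ, then x ≅ 0. -/
/-!
STATEMENT 2: Let `A` be a triangulated category with shift `Σ` admitting all
set-indexed coproducts and let `g` be a compact object of `A` with `A = loc(g)`.
If `Hom_A(g, Σ^j x) = 0` for all `j : ℤ`, then `x ≅ 0`.

Compactness of `g` is expressed by saying that the additive hom-functor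
`Hom_A(g, -) : A ⥤ AddCommGrp` (namely `preadditiveCoyoneda.obj (op g)`) preserves
all set-indexed coproducts, i.e. the canonical map `⨁ Hom(g, x_i) → Hom(g, ∐ x_i)`
is an isomorphism.
-/

open CategoryTheory CategoryTheory.Limits CategoryTheory.Pretriangulated ZeroObject

universe v u

variable (A : Type u) [Category.{v} A] [Preadditive A] [HasZeroObject A]
  [HasShift A ℤ] [∀ n : ℤ, (shiftFunctor A n).Additive] [Pretriangulated A]
  [HasCoproducts.{0} A]

/-- A localising subcategory of a triangulated category: a full triangulated
subcategory (closed under isomorphisms, shifts in both directions and cones of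
morphisms between its objects) that is closed under set-indexed coproducts. -/
structure IsLocalising (S : Set A) : Prop where
  mem_of_iso : ∀ {X Y : A}, (X ≅ Y) → X ∈ S → Y ∈ S
  zero_mem : (0 : A) ∈ S
  shift_mem : ∀ (X : A) (n : ℤ), X ∈ S → (X⟦n⟧ : A) ∈ S
  cone_mem : ∀ (Tr : Triangle A), Tr ∈ (distTriang A) → Tr.obj₁ ∈ S → Tr.obj₂ ∈ S →
    Tr.obj₃ ∈ S
  coprod_mem : ∀ {ι : Type} (f : ι → A), (∀ i, f i ∈ S) → (∐ f) ∈ S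

/-- If every morphism from `y` to a shift of `x` vanishes, then so does every morphism from a
shift of `y` to a shift of `x`. -/
lemma shift_hom_eq_zero {C : Type u} [Category.{v} C] [Preadditive C] [HasShift C ℤ]
    [∀ n : ℤ, (shiftFunctor C n).Additive] {x y : C}
    (h : ∀ (j : ℤ) (f : y ⟶ (x⟦j⟧ : C)), f = 0) (n j : ℤ)
    (f : (y⟦n⟧ : C) ⟶ (x⟦j⟧ : C)) : f = 0 := by
  have hf := h (j + -n) ((shiftShiftNeg y n).inv ≫ f⟦-n⟧' ≫ (shiftFunctorAdd C j (-n)).inv.app x)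
  rw [Preadditive.IsIso.comp_left_eq_zero, Preadditive.IsIso.comp_right_eq_zero] at hf
  exact (Functor.map_eq_zero_iff (shiftFunctor C (-n))).mp hf

/-- The objects with no nonzero morphism to any shift of `x` form a localising subcategory. -/
lemma isLocalising_setOf_hom_shift_eq_zero {C : Type u} [Category.{v} C] [Preadditive C]
    [HasZeroObject C] [HasShift C ℤ] [∀ n : ℤ, (shiftFunctor C n).Additive] [Pretriangulated C]
    [HasCoproducts.{0} C] (x : C) :
    IsLocalising C {y : C | ∀ (j : ℤ) (f : y ⟶ (x⟦j⟧ : C)), f = 0} where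
  mem_of_iso e hX j f := (Preadditive.IsIso.comp_left_eq_zero e.hom f).mp (hX j _)
  zero_mem _ f := (isZero_zero C).eq_of_src f 0
  shift_mem _ n hX j f := shift_hom_eq_zero hX n j f
  cone_mem T hT h₁ h₂ j f := by
    obtain ⟨k, rfl⟩ := Triangle.yoneda_exact₃ T hT f (h₂ j _)
    rw [shift_hom_eq_zero h₁ 1 j k, comp_zero]
  coprod_mem F hF j f := Sigma.hom_ext _ _ fun i => by
    rw [hF i j (Sigma.ι F i ≫ f), comp_zero]

/-- If `g` is a compact object of `A`, `A = loc(g)` and `Hom_A(g, Σ^j x) = 0` for all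
`j ∈ ℤ`, then `x ≅ 0`.  The hypothesis `A = loc(g)` is expressed by saying that every
object of `A` belongs to every localising subcategory containing `g`. -/
theorem isZero_of_hom_from_compact_localising_generator_eq_zero
    {A : Type u} [Category.{v} A] [Preadditive A] [HasZeroObject A]
    [HasShift A ℤ] [∀ n : ℤ, (shiftFunctor A n).Additive] [Pretriangulated A]
    [HasCoproducts.{0} A]
    (g : A)
    (hcompact : ∀ (ι : Type),
      PreservesColimitsOfShape (Discrete ι) (preadditiveCoyoneda.obj (Opposite.op g)))
    (hgen : ∀ (X : A) (S : Set A), IsLocalising A S → g ∈ S → X ∈ S)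
    (x : A) (hx : ∀ (j : ℤ) (f : g ⟶ (x⟦j⟧ : A)), f = 0) :
    IsZero x := by
  have hxx := hgen x _ (isLocalising_setOf_hom_shift_eq_zero x) hx
  rw [IsZero.iff_id_eq_zero]
  exact (Preadditive.IsIso.comp_right_eq_zero _ ((shiftFunctorZero A ℤ).inv.app x)).mp (hxx 0 _)
end

section
/- Let T be a triangulated category (with shift Σ) admitting all set-indexed coproducts, A a cocomplete abelian category, and B : T → A a homological functor preserving set-indexed coproducts. Let P be a wide subcategory of A closed under set-indexed coproducts. Let Y_0 → Y_1 → Y_2 → ⋯ be a sequence of morphisms in T such that B(Y_k) ∈ P and B(ΣY_k) ∈ P for all k ≥ 0. Then for any distinguished triangle ∐_{k≥0} Y_k --(1 − shift)--> ∐_{k≥0} Y_k → H → Σ∐_{k≥0} Y_k, where the map 1 − shift is the difference of the identity and the map induced by the structure morphisms Y_k → Y_{k+1}, the object H (the homotopy colimit of the sequence) satisfies B(H) ∈ P. -/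
/-!
STATEMENT 11: Let `T` be a triangulated category with all set-indexed coproducts, `A`
a cocomplete abelian category, and `B : T ⥤ A` a homological functor preserving
set-indexed coproducts.  Let `P` be a wide subcategory of `A` closed under set-indexed
coproducts.  Let `Y₀ → Y₁ → Y₂ → ⋯` be a sequence in `T` with `B(Y_k) ∈ P` and
`B(ΣY_k) ∈ P` for all `k`.  Then for any distinguished triangle
`∐ Y_k --(1 - shift)--> ∐ Y_k → H → Σ ∐ Y_k`, the homotopy colimit `H` satisfies
`B(H) ∈ P`.
-/

open CategoryTheory CategoryTheory.Limits CategoryTheory.Pretriangulated ZeroObject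

universe v u v₂ u₂

/-- A wide subcategory of an abelian category: a class of objects containing `0`,
closed under isomorphisms, under kernels and cokernels of morphisms between its
objects, and under extensions. -/
structure IsWide {D : Type*} [Category D] [Abelian D] (P : Set D) : Prop where
  mem_of_iso : ∀ {X Y : D}, (X ≅ Y) → X ∈ P → Y ∈ P
  zero_mem : (0 : D) ∈ P
  kernel_mem : ∀ {X Y : D} (f : X ⟶ Y), X ∈ P → Y ∈ P → kernel f ∈ P
  cokernel_mem : ∀ {X Y : D} (f : X ⟶ Y), X ∈ P → Y ∈ P → cokernel f ∈ P
  extension_mem : ∀ (S : ShortComplex D), S.ShortExact → S.X₁ ∈ P → S.X₃ ∈ P → S.X₂ ∈ P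

/-- The middle term of an exact sequence `X₀ ⟶ X₁ ⟶ X₂ ⟶ X₃ ⟶ X₄` lies in a wide subcategory
which contains the four outer terms. -/
theorem IsWide.mem_of_exact {D : Type*} [Category D] [Abelian D] {P : Set D} (hP : IsWide P)
    {X₀ X₁ X₂ X₃ X₄ : D} {f : X₀ ⟶ X₁} {g : X₁ ⟶ X₂} {h : X₂ ⟶ X₃} {k : X₃ ⟶ X₄}
    (wfg : f ≫ g = 0) (wgh : g ≫ h = 0) (whk : h ≫ k = 0)
    (exfg : (ShortComplex.mk f g wfg).Exact) (exgh : (ShortComplex.mk g h wgh).Exact)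
    (exhk : (ShortComplex.mk h k whk).Exact)
    (h₀ : X₀ ∈ P) (h₁ : X₁ ∈ P) (h₃ : X₃ ∈ P) (h₄ : X₄ ∈ P) : X₂ ∈ P := by
  have w : cokernel.desc f g wfg ≫ kernel.lift k h whk = 0 := by
    ext; simp [wgh]
  let S := ShortComplex.mk (cokernel.desc f g wfg) (kernel.lift k h whk) w
  have : Mono S.f := exfg.mono_cokernelDesc
  have : Epi S.g := exhk.epi_kernelLift
  have w' : cokernel.desc f g wfg ≫ h = 0 := by
    ext; simp [wgh]
  let S' := ShortComplex.mk (cokernel.desc f g wfg) h w'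
  let φ : ShortComplex.mk g h wgh ⟶ S' := { τ₁ := cokernel.π f, τ₂ := 𝟙 _, τ₃ := 𝟙 _ }
  let ψ : S ⟶ S' := { τ₁ := 𝟙 _, τ₂ := 𝟙 _, τ₃ := kernel.ι k }
  have : Epi φ.τ₁ := inferInstanceAs (Epi (cokernel.π f))
  have : IsIso φ.τ₂ := inferInstanceAs (IsIso (𝟙 X₂))
  have : Mono φ.τ₃ := inferInstanceAs (Mono (𝟙 X₃))
  have : Epi ψ.τ₁ := inferInstanceAs (Epi (𝟙 (cokernel f)))
  have : IsIso ψ.τ₂ := inferInstanceAs (IsIso (𝟙 X₂))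
  have : Mono ψ.τ₃ := inferInstanceAs (Mono (kernel.ι k))
  have hS : S.Exact := (ShortComplex.exact_iff_of_epi_of_isIso_of_mono ψ).2
    ((ShortComplex.exact_iff_of_epi_of_isIso_of_mono φ).1 exgh)
  exact hP.extension_mem S ⟨hS⟩ (hP.cokernel_mem f h₀ h₁) (hP.kernel_mem k h₃ h₄)

theorem hocolim_mem_preimage_wide
    {T : Type u} [Category.{v} T] [Preadditive T] [HasZeroObject T]
    [HasShift T ℤ] [∀ n : ℤ, (shiftFunctor T n).Additive] [Pretriangulated T]
    [HasCoproducts.{0} T]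
    {A : Type u₂} [Category.{v₂} A] [Abelian A] [HasColimitsOfSize.{0, 0} A]
    (B : T ⥤ A) [B.IsHomological]
    (hB : ∀ (ι : Type), PreservesColimitsOfShape (Discrete ι) B)
    (P : Set A) (hP : IsWide P)
    (hPcoprod : ∀ (ι : Type) (f : ι → A), (∀ i, f i ∈ P) → (∐ f) ∈ P)
    (Y : ℕ → T) (j : ∀ k : ℕ, Y k ⟶ Y (k + 1))
    (hY : ∀ k : ℕ, B.obj (Y k) ∈ P)
    (hShiftY : ∀ k : ℕ, B.obj ((Y k)⟦(1 : ℤ)⟧ : T) ∈ P)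
    (H : T) (g : (∐ Y) ⟶ H) (h : H ⟶ ((∐ Y)⟦(1 : ℤ)⟧ : T))
    (hT : Triangle.mk
        (𝟙 (∐ Y) - Sigma.desc (fun k => j k ≫ Sigma.ι Y (k + 1))) g h
      ∈ (distTriang T)) :
    B.obj H ∈ P := by
  have hsum : B.obj (∐ Y) ∈ P := by
    have := hB ℕ
    exact hP.mem_of_iso (PreservesCoproduct.iso B Y).symm (hPcoprod ℕ _ hY)
  have hshift : B.obj ((∐ Y)⟦(1 : ℤ)⟧) ∈ P := by
    have := hB ℕ
    exact hP.mem_of_iso (PreservesCoproduct.iso (shiftFunctor T (1 : ℤ) ⋙ B) Y).symm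
      (hPcoprod ℕ _ hShiftY)
  have hT₁ := rot_of_distTriang _ hT
  have hT₂ := rot_of_distTriang _ hT₁
  exact hP.mem_of_exact _ _ _ (B.map_distinguished_exact _ hT) (B.map_distinguished_exact _ hT₁)
    (B.map_distinguished_exact _ hT₂) hsum hsum hshift hshift
end
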